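/- arXiv:1710.08358 — 2 statements merged into one kernel-verified Lean document; each statement's English description precedes it below -/
import Mathlib

section
/- Let Z̃ be an E^ℤ-valued process with P(Z̃ = 0) = 0 and Σ_{h∈ℤ} E[‖Z̃_h‖^α] = 1. Then the measure ν defined by ν(A) = Σ_{h∈ℤ} ∫_0^∞ P(r B^h Z̃ ∈ A) α r^{−α−1} dr is a shift-invariant tail measure with index α. Conversely, if a process Z̃ gives a moving shift representation of a tail measure ν via this formula, then necessarily P(Z̃ = 0) = 0 and Σ_{h∈ℤ} E[‖Z̃_h‖^α] = ν({x : ‖x_0‖ > 1}) = 1. -/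
open MeasureTheory
open scoped ENNReal

/-- A measurable cone: a measurable space `E` with a measurable multiplication by positive
scalars, a zero element and a measurable `1`-homogeneous pseudonorm. -/
structure MeasCone (E : Type*) [MeasurableSpace E] where
  smul : ℝ → E → E
  zero : E
  nrm : E → ℝ
  measurable_smul : Measurable fun p : ℝ × E => smul p.1 p.2
  measurable_nrm : Measurable nrm
  one_smul : ∀ x, smul 1 x = x
  smul_smul : ∀ (u v : ℝ), 0 < u → 0 < v → ∀ x, smul u (smul v x) = smul (u * v) x
  smul_zero' : ∀ (u : ℝ), 0 < u → smul u zero = zero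
  nrm_nonneg : ∀ x, 0 ≤ nrm x
  nrm_smul : ∀ (u : ℝ), 0 < u → ∀ x, nrm (smul u x) = u * nrm x
  eq_zero_of_nrm : ∀ x, nrm x = 0 → x = zero

/-- The `k`-th iterate of the backshift operator: `(B^k x)_h = x_{h-k}`. -/
def seqShift {E : Type*} (k : ℤ) (x : ℤ → E) : ℤ → E := fun h => x (h - k)

/-- Shift invariance of a measure on `E^ℤ`: `ν(BA) = ν(A)` for all measurable `A`. -/
def ShiftInvariant {E : Type*} [MeasurableSpace E] (ν : MeasureTheory.Measure (ℤ → E)) : Prop :=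
  ∀ A : Set (ℤ → E), MeasurableSet A → ν (seqShift 1 '' A) = ν A

namespace MeasCone

variable {E : Type*} [MeasurableSpace E] (K : MeasCone E)

/-- The sequence identically equal to the zero element. -/
def zeroSeq : ℤ → E := fun _ => K.zero

/-- Componentwise scalar multiplication on the sequence space `E^ℤ`. -/
def sSmul (u : ℝ) (x : ℤ → E) : ℤ → E := fun h => K.smul u (x h)


/-- A tail measure with index `α > 0` on `E^ℤ`. -/
def IsTailMeasure (α : ℝ) (ν : Measure (ℤ → E)) : Prop :=
  ν {K.zeroSeq} = 0 ∧
  ν {x | 1 < K.nrm (x 0)} = 1 ∧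
  (∀ h : ℤ, ν {x | 1 < K.nrm (x h)} < ⊤) ∧
  ∀ (u : ℝ), 0 < u → ∀ A : Set (ℤ → E), MeasurableSet A →
    ν (K.sSmul u '' A) = ENNReal.ofReal (u ^ (-α)) * ν A

/-- The spectral map at lag `h`: `x ↦ x / ‖x_h‖`. -/
noncomputable def spectralMap (h : ℤ) (x : ℤ → E) : ℤ → E :=
  fun j => K.smul (K.nrm (x h))⁻¹ (x j)

/-- The law of the local spectral tail process of `ν` at lag `h`:
the pushforward under the spectral map of (the normalization of) the restriction of `ν`
to `{x : ‖x_h‖ > 1}`. -/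
noncomputable def spectralLaw (ν : Measure (ℤ → E)) (h : ℤ) : Measure (ℤ → E) :=
  Measure.map (K.spectralMap h)
    ((ν {x | 1 < K.nrm (x h)})⁻¹ • ν.restrict {x | 1 < K.nrm (x h)})

/-- The time change formula for (the law of) a process `Θ`:
`E[H₀(B^h Θ)] = E[‖Θ_h‖^α H₀(Θ)]` for every measurable `0`-homogeneous
`H₀ : E^ℤ → [0,∞)` vanishing on `{x : ‖x_0‖ = 0}`. -/
def SatisfiesTCF (α : ℝ) (μ : Measure (ℤ → E)) : Prop :=
  ∀ (h : ℤ) (H : (ℤ → E) → ℝ), Measurable H → (∀ x, 0 ≤ H x) →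
    (∀ (u : ℝ), 0 < u → ∀ x, H (K.sSmul u x) = H x) →
    (∀ x, K.nrm (x 0) = 0 → H x = 0) →
    ∫⁻ x, ENNReal.ofReal (H (seqShift h x)) ∂μ
      = ∫⁻ x, ENNReal.ofReal (K.nrm (x h) ^ α) * ENNReal.ofReal (H x) ∂μ

/-- `I(x) = j ∈ ℤ` for the infargmax functional:
`sup_{k ≤ j-1} ‖x_k‖ < ‖x_j‖ = sup_{k ∈ ℤ} ‖x_k‖`. -/
def IsInfArgmax (x : ℤ → E) (j : ℤ) : Prop :=
  (⨆ k : ℤ, ⨆ _ : k < j, ENNReal.ofReal (K.nrm (x k))) < ENNReal.ofReal (K.nrm (x j)) ∧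
  ENNReal.ofReal (K.nrm (x j)) = ⨆ k : ℤ, ENNReal.ofReal (K.nrm (x k))

end MeasCone

/-- The Pareto-type measure `α r^{-α-1} dr` on `(0, ∞)`. -/
noncomputable def paretoMeas (α : ℝ) : Measure ℝ :=
  (volume.restrict (Set.Ioi (0 : ℝ))).withDensity
    fun r => ENNReal.ofReal (α * r ^ (-α - 1))

theorem measurable_pareto_density (α : ℝ) :
    Measurable fun r : ℝ => ENNReal.ofReal (α * r ^ (-α - 1)) := by
  fun_prop

instance (α : ℝ) : SFinite (paretoMeas α) := by
  unfold paretoMeas; infer_instance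

theorem lintegral_paretoMeas (α : ℝ) {f : ℝ → ℝ≥0∞} (hf : Measurable f) :
    ∫⁻ r, f r ∂paretoMeas α
      = ∫⁻ r in Set.Ioi (0 : ℝ), f r * ENNReal.ofReal (α * r ^ (-α - 1)) := by
  rw [paretoMeas, lintegral_withDensity_eq_lintegral_mul _ (measurable_pareto_density α) hf]
  simp only [Pi.mul_apply, mul_comm]

theorem paretoMeas_one_lt_mul {α : ℝ} (hα : 0 < α) {c : ℝ} (hc : 0 ≤ c) :
    paretoMeas α {r | 1 < r * c} = ENNReal.ofReal (c ^ α) := by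
  rcases hc.eq_or_lt with rfl | hc
  · have : {r : ℝ | 1 < r * 0} = ∅ := by
      ext r
      simp [zero_le_one.not_gt]
    rw [this, measure_empty, Real.zero_rpow hα.ne', ENNReal.ofReal_zero]
  have hset : {r : ℝ | 1 < r * c} = Set.Ioi c⁻¹ := by
    ext r
    simp only [Set.mem_ofPred_eq, Set.mem_Ioi]
    rw [inv_lt_iff_one_lt_mul₀ hc]
  have hc' : 0 < c⁻¹ := inv_pos.mpr hc
  rw [hset, paretoMeas, withDensity_apply _ measurableSet_Ioi,
    Measure.restrict_restrict measurableSet_Ioi,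
    Set.inter_eq_self_of_subset_left (Set.Ioi_subset_Ioi hc'.le),
    ← ofReal_integral_eq_lintegral_ofReal
      ((integrableOn_Ioi_rpow_of_lt (by linarith) hc').const_mul α)]
  · rw [integral_const_mul, integral_Ioi_rpow_of_lt (by linarith) hc', sub_add_cancel,
      Real.rpow_neg hc'.le, Real.inv_rpow hc.le, inv_inv]
    congr 1
    field_simp
  · filter_upwards [ae_restrict_mem measurableSet_Ioi] with r hr
    have : 0 < r := hc'.trans hr
    positivity

theorem lintegral_Ioi_pareto_scale (α : ℝ) {u : ℝ} (hu : 0 < u) (g : ℝ → ℝ≥0∞) :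
    ∫⁻ r in Set.Ioi (0 : ℝ), g (u⁻¹ * r) * ENNReal.ofReal (α * r ^ (-α - 1))
      = ENNReal.ofReal (u ^ (-α))
        * ∫⁻ r in Set.Ioi (0 : ℝ), g r * ENNReal.ofReal (α * r ^ (-α - 1)) := by
  have himg : (fun r : ℝ => u * r) '' Set.Ioi 0 = Set.Ioi 0 := by
    rw [Set.image_mul_left_Ioi hu, mul_zero]
  have hder : ∀ x ∈ Set.Ioi (0 : ℝ), HasDerivWithinAt (fun r : ℝ => u * r) u (Set.Ioi 0) x :=
    fun x _ => by simpa using ((hasDerivAt_id x).const_mul u).hasDerivWithinAt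
  have hinj : Set.InjOn (fun r : ℝ => u * r) (Set.Ioi 0) :=
    (mul_right_injective₀ hu.ne').injOn
  conv_lhs => rw [← himg]
  rw [lintegral_image_eq_lintegral_abs_deriv_mul measurableSet_Ioi hder hinj,
    ← lintegral_const_mul' _ _ ENNReal.ofReal_ne_top]
  refine setLIntegral_congr_fun measurableSet_Ioi fun r hr => ?_
  have hr : 0 < r := hr
  have hpow : u * (α * (u * r) ^ (-α - 1)) = u ^ (-α) * (α * r ^ (-α - 1)) := by
    rw [Real.mul_rpow hu.le hr.le, Real.rpow_sub_one hu.ne']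
    field_simp
  simp only [inv_mul_cancel_left₀ hu.ne', abs_of_pos hu]
  rw [mul_left_comm, ← ENNReal.ofReal_mul hu.le, hpow, ENNReal.ofReal_mul (by positivity),
    mul_left_comm]

theorem measurable_seqShift {E : Type*} [MeasurableSpace E] (k : ℤ) :
    Measurable (seqShift k : (ℤ → E) → ℤ → E) :=
  measurable_pi_lambda _ fun _ => measurable_pi_apply _

theorem seqShift_seqShift {E : Type*} (k l : ℤ) (x : ℤ → E) :
    seqShift k (seqShift l x) = seqShift (k + l) x := by
  funext j
  simp only [seqShift]
  congr 1
  ring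

theorem seqShift_zero {E : Type*} (x : ℤ → E) : seqShift 0 x = x := by
  funext j
  simp [seqShift]

theorem image_seqShift_one {E : Type*} (A : Set (ℤ → E)) :
    seqShift 1 '' A = seqShift (-1) ⁻¹' A :=
  congrFun (Set.image_eq_preimage_of_inverse
    (fun x => by rw [seqShift_seqShift]; exact seqShift_zero x)
    (fun x => by rw [seqShift_seqShift]; exact seqShift_zero x)) A

namespace MeasCone

variable {E : Type*} [MeasurableSpace E] (K : MeasCone E)

theorem nrm_zero : K.nrm K.zero = 0 := by
  have h := K.nrm_smul 2 two_pos K.zero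
  rw [K.smul_zero' 2 two_pos] at h
  linarith

theorem nrm_eq_zero_iff {x : E} : K.nrm x = 0 ↔ x = K.zero :=
  ⟨K.eq_zero_of_nrm x, fun h => h ▸ K.nrm_zero⟩

theorem measurableSet_singleton_zeroSeq : MeasurableSet {K.zeroSeq} := by
  have : {K.zeroSeq} = ⋂ h : ℤ, {x : ℤ → E | K.nrm (x h) = 0} := by
    ext x
    simp [nrm_eq_zero_iff, zeroSeq, funext_iff]
  rw [this]
  exact MeasurableSet.iInter fun h =>
    (K.measurable_nrm.comp (measurable_pi_apply h)) (measurableSet_singleton 0)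

theorem measurableSet_one_lt_nrm (k : ℤ) : MeasurableSet {x : ℤ → E | 1 < K.nrm (x k)} :=
  (K.measurable_nrm.comp (measurable_pi_apply k)) measurableSet_Ioi

theorem measurable_sSmul (u : ℝ) : Measurable (K.sSmul u) :=
  measurable_pi_lambda _ fun h =>
    K.measurable_smul.comp (measurable_const.prodMk (measurable_pi_apply h))

theorem sSmul_sSmul {u v : ℝ} (hu : 0 < u) (hv : 0 < v) (x : ℤ → E) :
    K.sSmul u (K.sSmul v x) = K.sSmul (u * v) x :=
  funext fun h => K.smul_smul u v hu hv (x h)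

theorem sSmul_one (x : ℤ → E) : K.sSmul 1 x = x :=
  funext fun h => K.one_smul (x h)

theorem image_sSmul {u : ℝ} (hu : 0 < u) (A : Set (ℤ → E)) :
    K.sSmul u '' A = K.sSmul u⁻¹ ⁻¹' A :=
  congrFun (Set.image_eq_preimage_of_inverse
    (fun x => by
      rw [K.sSmul_sSmul (inv_pos.mpr hu) hu, inv_mul_cancel₀ hu.ne', sSmul_one])
    (fun x => by
      rw [K.sSmul_sSmul hu (inv_pos.mpr hu), mul_inv_cancel₀ hu.ne', sSmul_one])) A

theorem seqShift_sSmul (k : ℤ) (u : ℝ) (x : ℤ → E) :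
    seqShift k (K.sSmul u x) = K.sSmul u (seqShift k x) := rfl

theorem sSmul_seqShift_eq_zeroSeq_iff {r : ℝ} (hr : 0 < r) (h : ℤ) (x : ℤ → E) :
    K.sSmul r (seqShift h x) = K.zeroSeq ↔ x = K.zeroSeq := by
  constructor
  · intro hx
    funext j
    have hj := congrArg K.nrm (congrFun hx (j + h))
    simp only [sSmul, seqShift, zeroSeq, add_sub_cancel_right, K.nrm_smul r hr, nrm_zero,
      mul_eq_zero, hr.ne', false_or] at hj
    exact K.eq_zero_of_nrm _ hj
  · rintro rfl
    exact funext fun j => K.smul_zero' r hr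

variable {Ω : Type*} [MeasurableSpace Ω]

/-- Tonelli's theorem for the exceedance probabilities of a randomly scaled coordinate. -/
theorem lintegral_exceedance {α : ℝ} (hα : 0 < α) (P : Measure Ω) [SFinite P]
    {X : Ω → E} (hX : Measurable X) :
    ∫⁻ r in Set.Ioi (0 : ℝ), P {ω | 1 < K.nrm (K.smul r (X ω))}
        * ENNReal.ofReal (α * r ^ (-α - 1))
      = ∫⁻ ω, ENNReal.ofReal (K.nrm (X ω) ^ α) ∂P := by
  let S : Set (ℝ × Ω) := {p | 1 < p.1 * K.nrm (X p.2)}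
  have hS : MeasurableSet S :=
    measurableSet_lt measurable_const
      (measurable_fst.mul (K.measurable_nrm.comp (hX.comp measurable_snd)))
  have hsec (r : ℝ) (hr : r ∈ Set.Ioi (0 : ℝ)) :
      {ω | 1 < K.nrm (K.smul r (X ω))} = Prod.mk r ⁻¹' S := by
    ext ω
    simp only [S, Set.mem_preimage, Set.mem_ofPred_eq, K.nrm_smul r hr]
  have hcongr : ∫⁻ r in Set.Ioi (0 : ℝ), P {ω | 1 < K.nrm (K.smul r (X ω))}
        * ENNReal.ofReal (α * r ^ (-α - 1))
      = ∫⁻ r in Set.Ioi (0 : ℝ), P (Prod.mk r ⁻¹' S) * ENNReal.ofReal (α * r ^ (-α - 1)) :=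
    setLIntegral_congr_fun measurableSet_Ioi fun r hr => by simp only [hsec r hr]
  rw [hcongr, ← lintegral_paretoMeas α (measurable_measure_prodMk_left hS),
    ← Measure.prod_apply hS, Measure.prod_apply_symm hS]
  refine lintegral_congr fun ω => ?_
  rw [← paretoMeas_one_lt_mul hα (K.nrm_nonneg (X ω))]
  rfl

end MeasCone

open MeasCone in
/-- if `P(Z̃ = 0) = 0` and `Σ_h E[‖Z̃_h‖^α] = 1` then
`ν(A) = Σ_h ∫_0^∞ P(r B^h Z̃ ∈ A) α r^{-α-1} dr` is a shift-invariant tail measure; conversely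
if such a formula represents a tail measure `ν` then `P(Z̃ = 0) = 0` and
`Σ_h E[‖Z̃_h‖^α] = ν({x : ‖x_0‖ > 1}) = 1`. -/
theorem movingShiftRepresentation
    {E : Type*} [MeasurableSpace E] (K : MeasCone E) (α : ℝ) (hα : 0 < α)
    {Ω : Type*} [MeasurableSpace Ω] (P : Measure Ω) [IsProbabilityMeasure P]
    (Zt : Ω → ℤ → E) (hZmeas : Measurable Zt)
    (ν : Measure (ℤ → E))
    (hν : ∀ A : Set (ℤ → E), MeasurableSet A →
      ν A = ∑' h : ℤ, ∫⁻ r in Set.Ioi (0 : ℝ),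
        P {ω | K.sSmul r (seqShift h (Zt ω)) ∈ A}
          * ENNReal.ofReal (α * r ^ (-α - 1)) ∂volume) :
    ((P {ω | Zt ω = K.zeroSeq} = 0 ∧
        (∑' h : ℤ, ∫⁻ ω, ENNReal.ofReal (K.nrm (Zt ω h) ^ α) ∂P) = 1) →
      K.IsTailMeasure α ν ∧ ShiftInvariant ν) ∧
    (K.IsTailMeasure α ν →
      P {ω | Zt ω = K.zeroSeq} = 0 ∧
      (∑' h : ℤ, ∫⁻ ω, ENNReal.ofReal (K.nrm (Zt ω h) ^ α) ∂P) = ν {x | 1 < K.nrm (x 0)} ∧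
      ν {x | 1 < K.nrm (x 0)} = 1) := by
  have hexc (k : ℤ) : ν {x | 1 < K.nrm (x k)}
      = ∑' h : ℤ, ∫⁻ ω, ENNReal.ofReal (K.nrm (Zt ω h) ^ α) ∂P := by
    rw [hν _ (K.measurableSet_one_lt_nrm k), ← (Equiv.subLeft k).tsum_eq]
    refine tsum_congr fun h => ?_
    rw [← K.lintegral_exceedance hα P (measurable_pi_iff.mp hZmeas h)]
    simp only [Set.mem_ofPred_eq, sSmul, seqShift, Equiv.subLeft_apply, sub_sub_cancel]
  have hzero : ν {K.zeroSeq} = ∑' _ : ℤ, ∫⁻ r in Set.Ioi (0 : ℝ),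
      P {ω | Zt ω = K.zeroSeq} * ENNReal.ofReal (α * r ^ (-α - 1)) := by
    rw [hν _ K.measurableSet_singleton_zeroSeq]
    refine tsum_congr fun h => setLIntegral_congr_fun measurableSet_Ioi fun r hr => ?_
    simp only [Set.mem_singleton_iff, K.sSmul_seqShift_eq_zeroSeq_iff hr]
  constructor
  · rintro ⟨hP, hsum⟩
    refine ⟨⟨?_, ?_, fun h => ?_, fun u hu A hA => ?_⟩, fun A hA => ?_⟩
    · simp [hzero, hP]
    · rw [hexc, hsum]
    · rw [hexc, hsum]
      exact ENNReal.one_lt_top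
    · rw [K.image_sSmul hu, hν _ (K.measurable_sSmul _ hA), hν A hA, ← ENNReal.tsum_mul_left]
      refine tsum_congr fun h => ?_
      rw [← lintegral_Ioi_pareto_scale α hu
        fun r => P {ω | K.sSmul r (seqShift h (Zt ω)) ∈ A}]
      refine setLIntegral_congr_fun measurableSet_Ioi fun r hr => ?_
      simp only [Set.mem_preimage, K.sSmul_sSmul (inv_pos.mpr hu) hr]
    · rw [image_seqShift_one, hν _ (measurable_seqShift _ hA), hν A hA,
        ← (Equiv.addLeft (-1 : ℤ)).tsum_eq
          fun h : ℤ => ∫⁻ r in Set.Ioi (0 : ℝ),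
            P {ω | K.sSmul r (seqShift h (Zt ω)) ∈ A} * ENNReal.ofReal (α * r ^ (-α - 1))]
      simp only [Set.mem_preimage, K.seqShift_sSmul, seqShift_seqShift, Equiv.coe_addLeft]
  · rintro ⟨h0, h1, -, -⟩
    refine ⟨?_, (hexc 0).symm, h1⟩
    rw [hzero, ENNReal.tsum_eq_zero] at h0
    have h := h0 0
    rw [← lintegral_paretoMeas α measurable_const, lintegral_const, mul_eq_zero] at h
    refine h.resolve_right fun huniv => ?_
    have hone := paretoMeas_one_lt_mul hα zero_le_one
    rw [measure_mono_null (Set.subset_univ _) huniv] at hone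
    simp at hone
end

section
/- Let ν be a shift-invariant tail measure with index α > 0 and let τ : E^ℤ → [0,∞] be a measurable 1-homogeneous function with ν({x : τ(x) > 1}) = 1. Then the sequence u_n = ν({x : max_{0≤h≤n−1} τ(B^h x) > 1}), n ≥ 1, is subadditive (u_{m+n} ≤ u_m + u_n), and consequently the maximal index θ_τ = lim_{n→∞} u_n/n exists, equals inf_{n≥1} u_n/n, and lies in [0,1]. -/
open MeasureTheory
open scoped ENNReal

open Filter Topology in
/-- Fekete's lemma for finite `ℝ≥0∞`-valued subadditive sequences. -/
theorem ENNReal.tendsto_div_iInf_of_subadditive {u : ℕ → ℝ≥0∞} (hfin : ∀ n, u n ≠ ∞)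
    (hsub : ∀ m n, u (m + n) ≤ u m + u n) :
    Tendsto (fun n : ℕ => u n / (n : ℝ≥0∞)) atTop
      (𝓝 (⨅ n : {m : ℕ // 1 ≤ m}, u n.1 / (n.1 : ℝ≥0∞))) := by
  have hv : Subadditive fun n => (u n).toReal := fun m n => by
    rw [← ENNReal.toReal_add (hfin m) (hfin n)]
    exact ENNReal.toReal_mono (ENNReal.add_ne_top.2 ⟨hfin m, hfin n⟩) (hsub m n)
  have hbdd : BddBelow (Set.range fun n : ℕ => (u n).toReal / n) :=
    ⟨0, by rintro _ ⟨n, rfl⟩; positivity⟩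
  have heq : ∀ n : ℕ, 1 ≤ n → ENNReal.ofReal ((u n).toReal / n) = u n / n := fun n hn => by
    rw [ENNReal.ofReal_div_of_pos (by exact_mod_cast hn), ENNReal.ofReal_toReal (hfin n),
      ENNReal.ofReal_natCast]
  have hlim : Tendsto (fun n : ℕ => u n / (n : ℝ≥0∞)) atTop (𝓝 (ENNReal.ofReal hv.lim)) :=
    (ENNReal.tendsto_ofReal (hv.tendsto_lim hbdd)).congr'
      ((eventually_ge_atTop 1).mono heq)
  convert hlim using 2
  refine le_antisymm (ge_of_tendsto hlim ((eventually_ge_atTop 1).mono fun n hn => ?_))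
    (le_iInf fun n => ?_)
  · exact iInf_le (fun n : {m : ℕ // 1 ≤ m} => u n.1 / (n.1 : ℝ≥0∞)) ⟨n, hn⟩
  · rw [← heq n.1 n.2]
    exact ENNReal.ofReal_le_ofReal (hv.lim_le_div hbdd (Nat.one_le_iff_ne_zero.1 n.2))

theorem ShiftInvariant.measure_preimage {E : Type*} [MeasurableSpace E] {ν : Measure (ℤ → E)}
    (hs : ShiftInvariant ν) {A : Set (ℤ → E)} (hA : MeasurableSet A) (m : ℕ) :
    ν (seqShift (m : ℤ) ⁻¹' A) = ν A := by
  induction m with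
  | zero =>
    congr 1
    ext x
    simp [seqShift_zero]
  | succ m ih =>
    rw [← ih, ← hs _ (measurable_seqShift _ hA)]
    congr 1
    ext y
    constructor
    · rintro ⟨x, hx, rfl⟩
      simpa [seqShift_seqShift] using hx
    · intro hy
      refine ⟨seqShift (-1) y, ?_, ?_⟩
      · simpa [seqShift_seqShift] using hy
      · simp [seqShift_seqShift, seqShift_zero]

open MeasCone in
/-- for a shift-invariant tail measure `ν` and a `1`-homogeneous measurable
`τ` with `ν({τ > 1}) = 1`, the sequence `u_n = ν({max_{0 ≤ h ≤ n-1} τ(B^h x) > 1})` is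
subadditive, `u_n/n` converges to `inf_{n ≥ 1} u_n/n`, and this limit lies in `[0,1]`. -/
theorem maximalIndex_exists
    {E : Type*} [MeasurableSpace E] (K : MeasCone E) (α : ℝ) (hα : 0 < α)
    (ν : Measure (ℤ → E)) (hν : K.IsTailMeasure α ν) (hs : ShiftInvariant ν)
    (τ : (ℤ → E) → ℝ≥0∞) (hτmeas : Measurable τ)
    (hτhom : ∀ (u : ℝ), 0 < u → ∀ x, τ (K.sSmul u x) = ENNReal.ofReal u * τ x)
    (hτone : ν {x | 1 < τ x} = 1)
    (u : ℕ → ℝ≥0∞)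
    (hu : ∀ n : ℕ, u n = ν {x | ∃ h : ℕ, h < n ∧ 1 < τ (seqShift (h : ℤ) x)}) :
    (∀ m n : ℕ, u (m + n) ≤ u m + u n) ∧
    Filter.Tendsto (fun n : ℕ => u n / (n : ℝ≥0∞)) Filter.atTop
      (nhds (⨅ n : {m : ℕ // 1 ≤ m}, u n.1 / (n.1 : ℝ≥0∞))) ∧
    (⨅ n : {m : ℕ // 1 ≤ m}, u n.1 / (n.1 : ℝ≥0∞)) ≤ 1 := by
  have hmeas : ∀ n : ℕ,
      MeasurableSet {x | ∃ h : ℕ, h < n ∧ 1 < τ (seqShift (h : ℤ) x)} := fun n => by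
    have : {x | ∃ h : ℕ, h < n ∧ 1 < τ (seqShift (h : ℤ) x)}
        = ⋃ h : ℕ, ⋃ _ : h < n, {x | 1 < τ (seqShift (h : ℤ) x)} := by
      ext x
      simp
    rw [this]
    exact .iUnion fun h => .iUnion fun _ =>
      measurableSet_lt measurable_const (hτmeas.comp (measurable_seqShift _))
  have hsub : ∀ m n : ℕ, u (m + n) ≤ u m + u n := fun m n => by
    rw [hu, hu, hu, ← hs.measure_preimage (hmeas n) m]
    refine (measure_mono ?_).trans (measure_union_le _ _)
    rintro x ⟨h, hh, hx⟩
    rcases lt_or_ge h m with hm | hm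
    · exact Or.inl ⟨h, hm, hx⟩
    · refine Or.inr ⟨h - m, by omega, ?_⟩
      rw [seqShift_seqShift]
      convert hx using 3
      omega
  have hone : u 1 = 1 := by
    rw [hu]
    refine Eq.trans ?_ hτone
    congr 1
    ext x
    simp [seqShift_zero]
  have hfin : ∀ n, u n ≠ ∞ := fun n => by
    induction n with
    | zero => simp [hu]
    | succ n ih =>
      exact ne_top_of_le_ne_top (ENNReal.add_ne_top.2 ⟨ih, by simp [hone]⟩) (hsub n 1)
  refine ⟨hsub, ENNReal.tendsto_div_iInf_of_subadditive hfin hsub, ?_⟩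
  refine (iInf_le _ ⟨1, le_rfl⟩).trans ?_
  simp [hone]
end
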